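/- With F_I as above (I = [a,b], Δ > 0), one has |F_I(x)| ≤ 1 for all real x. -/

import Mathlib

open Real Set Classical

/-- The Fejér kernel `K(y) = (sin πy / (πy))²`, with `K(0) = 1`. -/
noncomputable def fejerK (y : ℝ) : ℝ :=
  if y = 0 then 1 else (Real.sin (Real.pi * y) / (Real.pi * y)) ^ 2

/-- Beurling's function `H(y) = (sin πy/π)² (∑_{n ∈ ℤ} sgn(n)/(y-n)² + 2/y)`,
extended by continuity (value `sgn y`) at the integers. -/
noncomputable def beurlingH (y : ℝ) : ℝ :=
  if ∃ n : ℤ, (n : ℝ) = y then Real.sign y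
  else (Real.sin (Real.pi * y) / Real.pi) ^ 2 *
    ((∑' n : ℤ, (Int.sign n : ℝ) / (y - (n : ℝ)) ^ 2) + 2 / y)

/-- Beurling's minorant `B⁻ = H - K` of the sign function. -/
noncomputable def Bminus (y : ℝ) : ℝ := beurlingH y - fejerK y

/-- The Beurling–Selberg minorant of the indicator of `[a,b]`. -/
noncomputable def selbergF (Δ a b x : ℝ) : ℝ :=
  (1 / 2) * (Bminus (Δ * (x - a)) + Bminus (Δ * (b - x)))


open Filter Topology MeasureTheory in
lemma parseval_aux (y : ℝ) (hy : ∀ n : ℤ, (n : ℝ) ≠ y) :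
    HasSum (fun n : ℤ => 1 / (y - (n : ℝ)) ^ 2) ((Real.pi / Real.sin (Real.pi * y)) ^ 2) := by
  have hab : (-(1/2) : ℝ) < 1/2 := by norm_num
  have hs : Real.sin (Real.pi * y) ≠ 0 := by
    intro h
    obtain ⟨n, hn⟩ := Real.sin_eq_zero_iff.1 h
    apply hy n
    have := Real.pi_pos
    field_simp at hn
    linarith
  let f : ℝ → ℂ := fun x => Complex.exp ((2 * π * y * x : ℝ) * Complex.I)
  have hf1 : ∀ x, ‖f x‖ = 1 := fun x => Complex.norm_exp_ofReal_mul_I _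
  have hfc : Continuous f := by fun_prop
  have hL2 : MemLp f 2 (volume.restrict (Ioc (-(1/2) : ℝ) (1/2))) :=
    MemLp.of_bound hfc.aestronglyMeasurable 1 (Eventually.of_forall fun x => (hf1 x).le)
  have h := hasSum_sq_fourierCoeffOn hab hL2
  have hsum : ((1/2 : ℝ) - -(1/2))⁻¹ • ∫ x in (-(1/2) : ℝ)..(1/2), ‖f x‖ ^ 2 = 1 := by
    simp only [hf1]
    norm_num
  rw [hsum] at h
  have hc : ∀ n : ℤ, ‖fourierCoeffOn hab f n‖ ^ 2
      = (Real.sin (Real.pi * y) / Real.pi) ^ 2 * (1 / (y - (n : ℝ)) ^ 2) := by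
    intro n
    have hyn : y - n ≠ 0 := fun h => hy n (by linarith)
    have hne : (2 * π * (y - n) * Complex.I : ℂ) ≠ 0 := by
      have : ((y - n : ℝ) : ℂ) ≠ 0 := by exact_mod_cast hyn
      push_cast at this
      simp [this, Real.pi_ne_zero]
    have e1 : fourierCoeffOn hab f n = ((Real.sin (π * (y - n)) / (π * (y - n)) : ℝ) : ℂ) := by
      rw [fourierCoeffOn_eq_integral]
      have : ∀ x : ℝ, fourier (-n) (x : AddCircle ((1/2 : ℝ) - -(1/2))) • f x
          = Complex.exp ((2 * π * (y - n) * Complex.I) * x) := by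
        intro x
        rw [fourier_coe_apply, smul_eq_mul, ← Complex.exp_add]
        congr 1
        push_cast
        ring
      simp_rw [this]
      rw [integral_exp_mul_complex hne]
      push_cast
      rw [Complex.sin]
      have e2 : (2 * π * (y - n) * Complex.I * (1/2) : ℂ) = π * (y - n) * Complex.I := by ring
      have e3 : (2 * π * (y - n) * Complex.I * (-(1/2)) : ℂ) = -(π * (y - n)) * Complex.I := by ring
      rw [e2, e3]
      have h3 : (y - n : ℂ) ≠ 0 := by exact_mod_cast hyn
      have h4 : (π : ℂ) ≠ 0 := by exact_mod_cast Real.pi_ne_zero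
      norm_num
      field_simp
      rw [Complex.I_sq]; ring
    have e4 : Real.sin (π * (y - n)) ^ 2 = Real.sin (π * y) ^ 2 := by
      have : π * (y - n) = π * y - n * π := by ring
      rw [this, Real.sin_sub_int_mul_pi, mul_pow]
      rw [← zpow_natCast, ← zpow_mul, mul_comm n, zpow_mul]; simp
    rw [e1, Complex.norm_real, Real.norm_eq_abs, sq_abs, div_pow, e4]
    field_simp
  simp_rw [hc] at h
  have h2 := h.mul_left ((Real.pi / Real.sin (Real.pi * y)) ^ 2)
  have := Real.pi_ne_zero
  rw [mul_one] at h2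
  have ef : (fun n : ℤ => 1 / (y - (n : ℝ)) ^ 2) = fun n : ℤ => (π / Real.sin (π * y)) ^ 2 *
      ((Real.sin (π * y) / π) ^ 2 * (1 / (y - (n : ℝ)) ^ 2)) := by
    ext n
    rw [← mul_assoc, ← mul_pow, div_mul_div_cancel₀ hs, div_self this]
    ring
  rw [ef]
  exact h2

lemma tail_bounds (y : ℝ) (hy : 0 < y) (hS : Summable fun n : ℕ => 1 / (y + (n + 1 : ℝ)) ^ 2) :
    1 / (y + 1) + 1 / (2 * (y + 1) ^ 2) ≤ ∑' n : ℕ, 1 / (y + (n + 1 : ℝ)) ^ 2 ∧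
    ∑' n : ℕ, 1 / (y + (n + 1 : ℝ)) ^ 2 ≤ 1 / (y + 1 / 2) := by
  constructor
  · have key : ∀ N : ℕ, 1 / (y + 1) + 1 / (2 * (y + 1) ^ 2)
        - (1 / (y + 1 + N) + 1 / 2 * (1 / (y + 1 + N)) * (1 / (y + 1 + N))) ≤
        ∑ n ∈ Finset.range N, 1 / (y + (n + 1 : ℝ)) ^ 2 := by
      intro N
      induction N with
      | zero => simp; field_simp; norm_num
      | succ N ih =>
        rw [Finset.sum_range_succ]
        push_cast
        have hN : (0 : ℝ) ≤ N := Nat.cast_nonneg N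
        obtain ⟨s, hs⟩ : ∃ s, s = y + 1 + N := ⟨_, rfl⟩
        have hs0 : 0 < s := by linarith
        have e1 : y + 1 + ((N : ℝ) + 1) = s + 1 := by rw [hs]; ring
        have e2 : y + ((N : ℝ) + 1) = s := by rw [hs]; ring
        rw [← hs] at ih
        rw [e1, e2]
        have : 1 / s ^ 2 - (1 / s + 1 / 2 * (1 / s) * (1 / s)
          - (1 / (s + 1) + 1 / 2 * (1 / (s + 1)) * (1 / (s + 1)))) = 1 / (2 * s ^ 2 * (s + 1) ^ 2) := by
          field_simp
          ring
        have : 0 < 1 / (2 * s ^ 2 * (s + 1) ^ 2) := by positivity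
        linarith
    have ht := hS.hasSum.tendsto_sum_nat
    have h0 : Filter.Tendsto (fun N : ℕ => 1 / (y + 1 + (N : ℝ))) Filter.atTop (nhds 0) :=
      Filter.Tendsto.div_atTop tendsto_const_nhds
        (Filter.tendsto_atTop_add_const_left _ _ tendsto_natCast_atTop_atTop)
    have h1 := ((h0.add ((h0.const_mul (1/2)).mul h0)).const_sub
      (1 / (y + 1) + 1 / (2 * (y + 1) ^ 2)))
    simp only [mul_zero, add_zero, sub_zero] at h1
    exact le_of_tendsto_of_tendsto' h1 ht key
  · apply Real.tsum_le_of_sum_range_le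
    · intro n; positivity
    · intro N
      suffices h : ∑ n ∈ Finset.range N, 1 / (y + (n + 1 : ℝ)) ^ 2 ≤
          1 / (y + 1 / 2) - 1 / (y + 1 / 2 + N) by
        have : 0 < 1 / (y + 1 / 2 + (N : ℝ)) := by positivity
        linarith
      induction N with
      | zero => simp
      | succ N ih =>
        rw [Finset.sum_range_succ]
        push_cast
        have hN : (0 : ℝ) ≤ N := Nat.cast_nonneg N
        have : 1 / (y + (N + 1 : ℝ)) ^ 2 ≤ 1 / (y + 1 / 2 + N) - 1 / (y + 1 / 2 + (N + 1)) := by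
          rw [div_sub_div _ _ (by positivity) (by positivity), div_le_div_iff₀ (by positivity) (by positivity)]
          nlinarith
        linarith

lemma H_formula (y : ℝ) (hy : 0 < y) : ∃ G : ℝ, beurlingH y = 1 - fejerK y * G ∧
    1 / (y + 1) ^ 2 ≤ G ∧ G ≤ 1 / (2 * y + 1) := by
  by_cases h : ∃ n : ℤ, (n : ℝ) = y
  · refine ⟨1 / (2 * y + 1), ?_, ?_, le_rfl⟩
    · have hK : fejerK y = 0 := by
        obtain ⟨n, rfl⟩ := h
        rw [fejerK, if_neg hy.ne', mul_comm, Real.sin_int_mul_pi]; simp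
      rw [hK, beurlingH, if_pos h, Real.sign_of_pos hy]; ring
    · apply one_div_le_one_div_of_le (by positivity); nlinarith
  · have h' : ∀ n : ℤ, (n : ℝ) ≠ y := fun n hn => h ⟨n, hn⟩
    have hP := parseval_aux y h'
    have hs : Real.sin (Real.pi * y) ≠ 0 := by
      intro h
      obtain ⟨n, hn⟩ := Real.sin_eq_zero_iff.1 h
      apply h' n
      have := Real.pi_pos
      field_simp at hn
      linarith
    have hA : Summable fun n : ℕ => 1 / (y - (n + 1 : ℝ)) ^ 2 := by
      have := hP.summable.comp_injective (i := fun n : ℕ => (n + 1 : ℤ)) (fun a b h => by simpa using h)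
      simpa [Function.comp_def] using this
    have hB : Summable fun n : ℕ => 1 / (y + (n + 1 : ℝ)) ^ 2 := by
      have := hP.summable.comp_injective (i := fun n : ℕ => (-(n + 1) : ℤ)) (fun a b h => by simpa using h)
      refine this.congr fun n => ?_
      simp only [Function.comp]
      push_cast
      rw [sub_neg_eq_add]
    have t1 := HasSum.of_add_one_of_neg_add_one (f := fun n : ℤ => 1 / (y - (n : ℝ)) ^ 2)
      (m := ∑' n : ℕ, 1 / (y - (n + 1 : ℝ)) ^ 2) (m' := ∑' n : ℕ, 1 / (y + (n + 1 : ℝ)) ^ 2)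
      (by simpa using hA.hasSum)
      (by convert hB.hasSum using 2; push_cast; rw [sub_neg_eq_add])
    have sp : ∀ n : ℕ, Int.sign ((n : ℤ) + 1) = 1 := fun n => Int.sign_eq_one_of_pos (by positivity)
    have sn : ∀ n : ℕ, Int.sign (-((n : ℤ) + 1)) = -1 := fun n => by rw [Int.sign_neg, sp]
    have t2 := HasSum.of_add_one_of_neg_add_one
      (f := fun n : ℤ => (Int.sign n : ℝ) / (y - (n : ℝ)) ^ 2)
      (m := ∑' n : ℕ, 1 / (y - (n + 1 : ℝ)) ^ 2) (m' := -∑' n : ℕ, 1 / (y + (n + 1 : ℝ)) ^ 2)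
      (by convert hA.hasSum using 2; rw [sp]; push_cast; rfl)
      (by
        have hn := hB.hasSum.neg
        have ef : (fun n : ℕ => (Int.sign (-((n : ℤ) + 1)) : ℝ) / (y - ((-((n : ℤ) + 1) : ℤ) : ℝ)) ^ 2)
            = fun n : ℕ => -(1 / (y + (n + 1 : ℝ)) ^ 2) := by
          ext n
          rw [sn]; push_cast; rw [sub_neg_eq_add]; ring
        rw [ef]
        exact hn)
    have t3 := hP.unique t1
    obtain ⟨b1, b2⟩ := tail_bounds y hy hB
    set B := ∑' n : ℕ, 1 / (y + (n + 1 : ℝ)) ^ 2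
    set A := ∑' n : ℕ, 1 / (y - (n + 1 : ℝ)) ^ 2
    have hpi := Real.pi_pos
    refine ⟨1 - 2 * y + 2 * y ^ 2 * B, ?_, ?_, ?_⟩
    · rw [beurlingH, if_neg h, fejerK, if_neg hy.ne', t2.tsum_eq]
      simp only [Int.sign_zero, Int.cast_zero, sub_zero, zero_div, add_zero] at t3 ⊢
      have hA' : A = (π / Real.sin (π * y)) ^ 2 - 1 / y ^ 2 - B := by linarith
      rw [hA']
      field_simp
      ring
    · have : 1 / (y + 1) ^ 2 = 1 - 2 * y + 2 * y ^ 2 * (1 / (y + 1) + 1 / (2 * (y + 1) ^ 2)) := by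
        field_simp
        ring
      rw [this]
      gcongr
    · have : 1 / (2 * y + 1) = 1 - 2 * y + 2 * y ^ 2 * (1 / (y + 1 / 2)) := by
        field_simp
        ring
      rw [this]
      gcongr

lemma H_odd (y : ℝ) : beurlingH (-y) = -beurlingH y := by
  unfold beurlingH
  have e : (∃ n : ℤ, (n : ℝ) = -y) ↔ ∃ n : ℤ, (n : ℝ) = y :=
    ⟨fun ⟨n, hn⟩ => ⟨-n, by push_cast; linarith⟩, fun ⟨n, hn⟩ => ⟨-n, by push_cast; linarith⟩⟩
  by_cases h : ∃ n : ℤ, (n : ℝ) = y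
  · rw [if_pos h, if_pos (e.2 h), Real.sign_neg]
  · rw [if_neg h, if_neg (fun h' => h (e.1 h'))]
    have : ∑' n : ℤ, (Int.sign n : ℝ) / (-y - (n : ℝ)) ^ 2
        = - ∑' n : ℤ, (Int.sign n : ℝ) / (y - (n : ℝ)) ^ 2 := by
      rw [← tsum_neg, ← (Equiv.neg ℤ).tsum_eq]
      congr 1
      ext n
      simp only [Equiv.neg_apply, Int.sign_neg]
      push_cast
      rw [show -y - -(n : ℝ) = -(y - n) by ring, neg_sq]
      ring
    rw [this, mul_neg, Real.sin_neg, div_neg]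
    ring

lemma K_even (y : ℝ) : fejerK (-y) = fejerK y := by
  unfold fejerK
  simp

lemma K_nonneg (y : ℝ) : 0 ≤ fejerK y := by
  unfold fejerK
  split_ifs <;> positivity

lemma K_bound (y : ℝ) (hy : 0 < y) (hy1 : y ≤ 1) : fejerK y ≤ 1 - y ^ 2 / 2 := by
  have hpi := Real.pi_pos
  rw [fejerK, if_neg hy.ne']
  have h0 : 0 ≤ Real.sin (π * y) / (π * y) :=
    div_nonneg (Real.sin_nonneg_of_nonneg_of_le_pi (by positivity) (by nlinarith)) (by positivity)
  have h1 : Real.sin (π * y) / (π * y) ≤ 1 - y ^ 2 / 2 := by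
    rw [div_le_iff₀ (by positivity)]
    have e : π * y = 2 * (π * y / 2) := by ring
    have c := Real.cos_le_one_sub_mul_cos_sq (x := π * y / 2) (by
      rw [abs_of_pos (by positivity)]; nlinarith)
    have c' : 1 - 2 / π ^ 2 * (π * y / 2) ^ 2 = 1 - y ^ 2 / 2 := by field_simp
    rw [c'] at c
    have s := Real.sin_le (x := π * y / 2) (by positivity)
    have c0 : 0 ≤ Real.cos (π * y / 2) := Real.cos_nonneg_of_mem_Icc ⟨by nlinarith, by nlinarith⟩
    have : Real.sin (π * y) = 2 * Real.sin (π * y / 2) * Real.cos (π * y / 2) := by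
      rw [← Real.sin_two_mul, ← e]
    rw [this]
    have : 0 < π * y := by positivity
    nlinarith [mul_le_mul_of_nonneg_right s c0]
  nlinarith [mul_le_mul h1 h1 h0 (h0.trans h1), sq_nonneg y]

lemma K_bound2 (y : ℝ) (hy : 1 < y) : fejerK y ≤ 1 / 2 := by
  rw [fejerK, if_neg (by linarith), div_pow, div_le_iff₀ (by positivity)]
  have h1 := Real.sin_sq_le_one (π * y)
  have h2 := Real.pi_gt_three
  have h3 : 3 ≤ π * y := by nlinarith
  nlinarith

lemma K_le_one (y : ℝ) (hy : 0 < y) : fejerK y ≤ 1 := by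
  rcases le_or_gt y 1 with h | h
  · nlinarith [K_bound y hy h, sq_nonneg y]
  · linarith [K_bound2 y h]

lemma B_zero : Bminus 0 = -1 := by
  have : ∃ n : ℤ, (n : ℝ) = 0 := ⟨0, by simp⟩
  simp [Bminus, beurlingH, fejerK, this]

lemma G_bounds {y G : ℝ} (hy : 0 < y) (h1 : 1 / (y + 1) ^ 2 ≤ G) (h2 : G ≤ 1 / (2 * y + 1)) :
    0 ≤ G ∧ G ≤ 1 := by
  constructor
  · exact le_trans (by positivity) h1
  · refine h2.trans ?_
    rw [div_le_one (by positivity)]; linarith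

lemma B_le_one (y : ℝ) : Bminus y ≤ 1 := by
  rcases lt_trichotomy y 0 with h | h | h
  · obtain ⟨G, hG, h1, h2⟩ := H_formula (-y) (by linarith)
    obtain ⟨g0, g1⟩ := G_bounds (by linarith) h1 h2
    rw [H_odd, K_even] at hG
    have := K_nonneg y
    unfold Bminus
    nlinarith
  · rw [h, B_zero]; norm_num
  · obtain ⟨G, hG, h1, h2⟩ := H_formula y h
    obtain ⟨g0, g1⟩ := G_bounds h h1 h2
    have := K_nonneg y
    unfold Bminus
    nlinarith

lemma B_ge (y : ℝ) (hy : 0 ≤ y) : -1 ≤ Bminus y := by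
  rcases hy.eq_or_lt with h | h
  · rw [← h, B_zero]
  · obtain ⟨G, hG, h1, h2⟩ := H_formula y h
    obtain ⟨g0, g1⟩ := G_bounds h h1 h2
    have := K_nonneg y
    have := K_le_one y h
    unfold Bminus
    nlinarith

lemma B_mixed (u v : ℝ) (hv : v < 0) (huv : 0 < u + v) : -2 ≤ Bminus u + Bminus v := by
  obtain ⟨w, rfl⟩ : ∃ w, v = -w := ⟨-v, by ring⟩
  have hw : 0 < w := by linarith
  have hu : 0 < u := by linarith
  obtain ⟨G, hG, h1, h2⟩ := H_formula u hu
  obtain ⟨g0, g1⟩ := G_bounds hu h1 h2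
  obtain ⟨G', hG', h1', h2'⟩ := H_formula w hw
  obtain ⟨g0', g1'⟩ := G_bounds hw h1' h2'
  have kw := K_nonneg w
  have kw1 := K_le_one w hw
  have ku := K_nonneg u
  unfold Bminus
  rw [H_odd, K_even, hG, hG']
  have m1 : fejerK w * (1 - G') ≤ 1 - G' := by nlinarith
  have m2 : 1 / (u + 1) ^ 2 ≤ G' := by
    refine le_trans ?_ h1'
    apply one_div_le_one_div_of_le (by positivity)
    nlinarith
  suffices h : fejerK u * (1 + G) ≤ 1 + G' by nlinarith
  rcases le_or_gt u 1 with h | h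
  · have k := K_bound u hu h
    have : fejerK u * (1 + G) ≤ (1 - u ^ 2 / 2) * (1 + 1 / (2 * u + 1)) := by
      apply mul_le_mul k (by linarith) (by linarith) (by linarith)
    have : (1 - u ^ 2 / 2) * (1 + 1 / (2 * u + 1)) ≤ 1 + 1 / (u + 1) ^ 2 := by
      have e : 1 + 1 / (u + 1) ^ 2 - (1 - u ^ 2 / 2) * (1 + 1 / (2 * u + 1))
          = u ^ 2 * ((u + 1) ^ 3 - 1) / ((2 * u + 1) * (u + 1) ^ 2) := by
        field_simp
        ring
      have : 0 ≤ u ^ 2 * ((u + 1) ^ 3 - 1) / ((2 * u + 1) * (u + 1) ^ 2) := by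
        apply div_nonneg _ (by positivity)
        have : (u + 1) ^ 3 - 1 = u ^ 3 + 3 * u ^ 2 + 3 * u := by ring
        rw [this]; positivity
      linarith
    linarith
  · have k := K_bound2 u h
    nlinarith

/-- Lemma 6.1 of the paper: `|F_I(x)| ≤ 1` for all real `x`. -/
theorem selbergF_bounded (Δ a b : ℝ) (hΔ : 0 < Δ) (hab : a < b) (x : ℝ) :
    |selbergF Δ a b x| ≤ 1 := by
  have hsum : 0 < Δ * (x - a) + Δ * (b - x) := by nlinarith
  unfold selbergF
  generalize Δ * (x - a) = u at *
  generalize Δ * (b - x) = v at *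
  have hu := B_le_one u
  have hv := B_le_one v
  have hl : -2 ≤ Bminus u + Bminus v := by
    rcases lt_or_ge v 0 with h | h
    · exact B_mixed u v h hsum
    · rcases lt_or_ge u 0 with h' | h'
      · have := B_mixed v u h' (by linarith)
        linarith
      · linarith [B_ge u h', B_ge v h]
  rw [abs_le]
  constructor <;> linarith
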